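/- Let X be at the same time a simplicial complex of rank n ≥ 0 and an n-PCM. Then the border ΔX equals the downward closure of its (n−1)-dimensional simplices: ΔX = {h ∈ X : there exists a simplex h' ∈ ΔX of dimension n−1 with h ⊆ h'}. -/

import Mathlib

namespace PCMPaper

variable {α : Type*} [PartialOrder α]

/-- The set of elements of `X` strictly below `h` (α□_X(h)). -/
def alphaS (X : Set α) (h : α) : Set α := {x ∈ X | x < h}

/-- The set of elements of `X` strictly above `h` (β□_X(h)). -/
def betaS (X : Set α) (h : α) : Set α := {x ∈ X | h < x}

/-- The (strict) neighborhood θ□_X(h) = α□_X(h) ∪ β□_X(h). -/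
def thetaS (X : Set α) (h : α) : Set α := alphaS X h ∪ betaS X h

/-- The rank of `h` in the poset `X`: the maximal length of a strictly increasing
chain in `X` ending at `h`.  (It equals 0 when α□_X(h) = ∅ and
`max_{x ∈ α□_X(h)} rank X x + 1` otherwise, for finite `X`.) -/
noncomputable def rank (X : Set α) (h : α) : ℕ :=
  sSup {n : ℕ | ∃ c : Fin (n + 1) → α, StrictMono c ∧ (∀ i, c i ∈ X) ∧ c (Fin.last n) = h}

open scoped Classical in
/-- The rank of the poset `X`: maximal rank of its elements, `-1` if empty. -/
noncomputable def rankSet (X : Set α) : ℤ :=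
  if X = ∅ then -1 else ((sSup (rank X '' X) : ℕ) : ℤ)

/-- One step of a path in `X`: two distinct comparable elements of `X`. -/
def rel (X : Set α) (x y : α) : Prop :=
  x ∈ X ∧ y ∈ X ∧ x ≠ y ∧ (x < y ∨ y < x)

/-- `X` is (path-)connected: any two elements are joined by a path in `X`. -/
def IsConnected (X : Set α) : Prop :=
  ∀ x ∈ X, ∀ y ∈ X, Relation.ReflTransGen (rel X) x y

/-- `IsSurfaceAux (k + 1) X` means that `X` is a (discrete) `k`-surface. -/
def IsSurfaceAux : ℕ → Set α → Prop
  | 0, X => X = ∅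
  | 1, X => ∃ x y : α, x ≠ y ∧ ¬ x < y ∧ ¬ y < x ∧ X = {x, y}
  | (n + 2), X => X.Nonempty ∧ IsConnected X ∧ ∀ h ∈ X, IsSurfaceAux (n + 1) (thetaS X h)

/-- `X` is a discrete `k`-surface (`k : ℤ`, `k ≥ -1`). -/
def IsSurface (k : ℤ) (X : Set α) : Prop :=
  ∃ n : ℕ, (n : ℤ) = k + 1 ∧ IsSurfaceAux n X

/-- The border ΔX of a poset `X` of rank `n`:
elements whose neighborhood is not an `(n-1)`-surface. -/
def border (X : Set α) : Set α :=
  {h ∈ X | ¬ IsSurface (rankSet X - 1) (thetaS X h)}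

/-- The interior of `X`. -/
def interior' (X : Set α) : Set α := X \ border X

/-- `IsPCMAux (n + 1) X` means that `X` is an `n`-PCM. -/
def IsPCMAux : ℕ → Set α → Prop
  | 0, X => X = ∅
  | 1, X => ∃ x : α, X = {x}
  | (n + 2), X => rankSet X = ((n : ℤ) + 1) ∧ IsConnected X ∧ border X ≠ ∅ ∧
      ∀ h ∈ X, (h ∈ border X → IsPCMAux (n + 1) (thetaS X h)) ∧
               (h ∉ border X → IsSurfaceAux (n + 1) (thetaS X h))

/-- `X` is an `k`-PCM (`k : ℤ`, `k ≥ -1`). -/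
def IsPCM (k : ℤ) (X : Set α) : Prop :=
  ∃ n : ℕ, (n : ℤ) = k + 1 ∧ IsPCMAux n X

/-- Fuel-indexed coherence. -/
def IsCoherentAux : ℕ → Set α → Prop
  | 0, X => X = ∅
  | (n + 1), X => X = ∅ ∨
      ∀ h ∈ X, rankSet (thetaS X h) = rankSet X - 1 ∧ IsCoherentAux n (thetaS X h)

/-- `X` is a coherent poset. -/
def IsCoherent (X : Set α) : Prop := ∃ n : ℕ, IsCoherentAux n X

/-- `X` is a separated union of `(m-1)`-surfaces: a union of `(m-1)`-surfaces such
that no element of one of them is comparable to an element of another one. -/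
def IsSeparatedUnionOfSurfacesAux (m : ℕ) (X : Set α) : Prop :=
  ∃ P : Set (Set α), P.Nonempty ∧ X = ⋃₀ P ∧ (∀ S ∈ P, IsSurfaceAux m S) ∧
    ∀ S ∈ P, ∀ T ∈ P, S ≠ T → ∀ x ∈ S, ∀ y ∈ T, ¬ x ≤ y ∧ ¬ y ≤ x

/-- `IsSmoothPCMAux (n + 1) X` means that `X` is a smooth `n`-PCM. -/
def IsSmoothPCMAux : ℕ → Set α → Prop
  | 0, X => X = ∅
  | 1, X => ∃ x : α, X = {x}
  | (n + 2), X => rankSet X = ((n : ℤ) + 1) ∧ IsConnected X ∧ border X ≠ ∅ ∧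
      IsSeparatedUnionOfSurfacesAux (n + 1) (border X) ∧
      ∀ h ∈ X, IsSurfaceAux (n + 1) (thetaS X h) ∨ IsSmoothPCMAux (n + 1) (thetaS X h)

/-- `X` is a smooth `k`-PCM (`k : ℤ`, `k ≥ -1`). -/
def IsSmoothPCM (k : ℤ) (X : Set α) : Prop :=
  ∃ n : ℕ, (n : ℤ) = k + 1 ∧ IsSmoothPCMAux n X

/-- A simplicial complex: a finite family of nonempty finite sets, closed under
taking nonempty subsets and under nonempty intersections. -/
def IsSimplicialComplex {V : Type*} [DecidableEq V] (X : Set (Finset V)) : Prop :=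
  X.Finite ∧ (∀ h ∈ X, h.Nonempty) ∧
  (∀ h ∈ X, ∀ h' : Finset V, h'.Nonempty → h' ⊆ h → h' ∈ X) ∧
  (∀ h ∈ X, ∀ h' ∈ X, (h ∩ h').Nonempty → h ∩ h' ∈ X)

/-- The dimension of a simplex. -/
def dim {V : Type*} (h : Finset V) : ℤ := (h.card : ℤ) - 1

/-- The link of a simplex `h` in a family of simplices `S`. -/
def link {V : Type*} [DecidableEq V] (h : Finset V) (S : Set (Finset V)) : Set (Finset V) :=
  {h' ∈ S | h ∩ h' = ∅ ∧ h ∪ h' ∈ S}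

/-- `X` is pure of rank `n`: every simplex is contained in an `n`-dimensional one. -/
def Pure {V : Type*} (X : Set (Finset V)) (n : ℤ) : Prop :=
  ∀ h ∈ X, ∃ g ∈ X, h ⊆ g ∧ dim g = n

/-- Any two `n`-simplices of `X` are joined by a path in `X` all of whose elements
are simplices of dimension `n - 1` or `n` (i.e. `X` is `(n-1)`-connected). -/
def NConnected {V : Type*} (X : Set (Finset V)) (n : ℤ) : Prop :=
  ∀ a ∈ X, dim a = n → ∀ b ∈ X, dim b = n →
    Relation.ReflTransGen (rel {h | h ∈ X ∧ (dim h = n - 1 ∨ dim h = n)}) a b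

/-- `X` is a pseudomanifold of rank `n`. -/
def IsPseudomanifold {V : Type*} [DecidableEq V] (X : Set (Finset V)) (n : ℤ) : Prop :=
  IsSimplicialComplex X ∧ rankSet X = n ∧
  ((n = 0 ∧ ∃ v : V, X = {({v} : Finset V)}) ∨
   (1 ≤ n ∧ Pure X n ∧
    (∀ h ∈ X, dim h = n - 1 →
      Set.ncard {g | g ∈ X ∧ h ⊆ g ∧ dim g = n} ∈ ({1, 2} : Set ℕ)) ∧
    NConnected X n))

/-- `X` is a normal pseudomanifold of rank `n`: a pseudomanifold such that the link
of every simplex of dimension at most `n - 2` is a pseudomanifold. -/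
def IsNormalPseudomanifold {V : Type*} [DecidableEq V] (X : Set (Finset V)) (n : ℤ) : Prop :=
  IsPseudomanifold X n ∧
  ∀ h ∈ X, dim h ≤ n - 2 → IsPseudomanifold (link h X) (n - dim h - 1)

section Join

variable {A B X : Set α}

lemma mem_thetaS {h x : α} : x ∈ thetaS X h ↔ x ∈ X ∧ (x < h ∨ h < x) := by
  simp only [thetaS, alphaS, betaS, Set.mem_union, Set.mem_ofPred_eq]
  tauto

lemma IsSurfaceAux.nonempty {n : ℕ} (hX : IsSurfaceAux (n + 1) X) : X.Nonempty := by
  cases n with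
  | zero =>
    obtain ⟨x, y, -, -, -, rfl⟩ := hX
    exact ⟨x, by simp⟩
  | succ n => exact hX.1

lemma IsSurfaceAux.thetaS {n : ℕ} (hX : IsSurfaceAux (n + 1) X) {h : α} (hh : h ∈ X) :
    IsSurfaceAux n (thetaS X h) := by
  cases n with
  | zero =>
    obtain ⟨x, y, -, hxy, hyx, rfl⟩ := hX
    change PCMPaper.thetaS _ h = ∅
    ext z
    simp only [mem_thetaS, Set.mem_insert_iff, Set.mem_singleton_iff, Set.mem_empty_iff_false,
      iff_false] at hh ⊢
    rcases hh with rfl | rfl <;> rintro ⟨rfl | rfl, hz⟩ <;> simp_all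
  | succ n => exact hX.2.2 h hh

lemma IsSurfaceAux.nontrivial {n : ℕ} (hX : IsSurfaceAux (n + 1) X) : X.Nontrivial := by
  cases n with
  | zero =>
    obtain ⟨x, y, hne, -, -, rfl⟩ := hX
    exact Set.nontrivial_pair hne
  | succ n =>
    obtain ⟨x, hx⟩ := hX.nonempty
    obtain ⟨y, hy⟩ := (hX.thetaS hx).nonempty
    rw [mem_thetaS] at hy
    refine ⟨x, hx, y, hy.1, ?_⟩
    rintro rfl
    simp at hy

/-- The neighborhood of an element of the lower part of a join. -/
lemma thetaS_join_left (hAB : ∀ a ∈ A, ∀ b ∈ B, a < b) {a : α} (ha : a ∈ A) :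
    thetaS (A ∪ B) a = thetaS A a ∪ B := by
  ext z
  simp only [mem_thetaS, Set.mem_union]
  have := hAB a ha z
  tauto

/-- The neighborhood of an element of the upper part of a join. -/
lemma thetaS_join_right (hAB : ∀ a ∈ A, ∀ b ∈ B, a < b) {b : α} (hb : b ∈ B) :
    thetaS (A ∪ B) b = A ∪ thetaS B b := by
  ext z
  simp only [mem_thetaS, Set.mem_union]
  have := fun hz => hAB z hz b hb
  tauto

lemma Ioo_lt_betaS {s h : α} : ∀ a ∈ Set.Ioo s h, ∀ b ∈ betaS X h, a < b :=
  fun _ ha _ hb => ha.2.trans hb.2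

lemma rel.symm {x y : α} (h : rel X x y) : rel X y x :=
  ⟨h.2.1, h.1, h.2.2.1.symm, h.2.2.2.symm⟩

lemma rel.of_lt {x y : α} (hx : x ∈ X) (hy : y ∈ X) (h : x < y) : rel X x y :=
  ⟨hx, hy, h.ne, Or.inl h⟩

lemma isConnected_join (hAB : ∀ a ∈ A, ∀ b ∈ B, a < b) (hA : A.Nonempty) (hB : B.Nonempty) :
    IsConnected (A ∪ B) := by
  obtain ⟨a₀, ha₀⟩ := hA
  obtain ⟨b₀, hb₀⟩ := hB
  have key : ∀ a ∈ A, ∀ b ∈ B, rel (A ∪ B) a b := fun a ha b hb =>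
    rel.of_lt (Or.inl ha) (Or.inr hb) (hAB a ha b hb)
  rintro x (hx | hx) y (hy | hy)
  · exact .head (key x hx b₀ hb₀) (.single (key y hy b₀ hb₀).symm)
  · exact .single (key x hx y hy)
  · exact .single (key y hy x hx).symm
  · exact .head (key a₀ ha₀ x hx).symm (.single (key a₀ ha₀ y hy))

/-- The join of two surfaces is a surface. -/
lemma IsSurfaceAux.join {m l : ℕ} (hAB : ∀ a ∈ A, ∀ b ∈ B, a < b)
    (hA : IsSurfaceAux m A) (hB : IsSurfaceAux l B) : IsSurfaceAux (m + l) (A ∪ B) := by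
  induction hN : m + l using Nat.strong_induction_on generalizing m l A B with
  | _ N ih =>
  subst hN
  rcases m with _ | m
  · obtain rfl : A = ∅ := hA
    simpa using hB
  rcases l with _ | l
  · obtain rfl : B = ∅ := hB
    simpa using hA
  have hN : m + 1 + (l + 1) = m + l + 2 := by ring
  rw [hN]
  refine ⟨hA.nonempty.inl, isConnected_join hAB hA.nonempty hB.nonempty, ?_⟩
  rintro x (hx | hx)
  · rw [thetaS_join_left hAB hx]
    exact ih _ (by omega) (fun a ha => hAB a (mem_thetaS.1 ha).1) (hA.thetaS hx) hB (by omega)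
  · rw [thetaS_join_right hAB hx]
    exact ih _ (by omega) (fun a ha b hb => hAB a ha b (mem_thetaS.1 hb).1) hA (hB.thetaS hx)
      (by omega)

/-- If a join is a surface and its lower part is a surface, so is its upper part. -/
lemma IsSurfaceAux.of_join {N m : ℕ} (hAB : ∀ a ∈ A, ∀ b ∈ B, a < b)
    (h : IsSurfaceAux N (A ∪ B)) (hA : IsSurfaceAux m A) :
    ∃ l, N = m + l ∧ IsSurfaceAux l B := by
  induction m generalizing N A with
  | zero =>
    obtain rfl : A = ∅ := hA
    exact ⟨N, by omega, by simpa using h⟩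
  | succ m ih =>
    obtain ⟨x, hx⟩ := hA.nonempty
    rcases N with _ | N
    · have h0 : A ∪ B = ∅ := h
      exact absurd (h0 ▸ Or.inl hx : x ∈ (∅ : Set α)) (by simp)
    have hθ := h.thetaS (Or.inl hx : x ∈ A ∪ B)
    rw [thetaS_join_left hAB hx] at hθ
    obtain ⟨l, hl, hB⟩ := ih (fun a ha => hAB a (mem_thetaS.1 ha).1) hθ (hA.thetaS hx)
    exact ⟨l, by omega, hB⟩

lemma isSurface_natCast_sub_one {n : ℕ} {k : ℤ} (hk : k = n - 1) :
    IsSurface k X ↔ IsSurfaceAux n X := by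
  constructor
  · rintro ⟨N, hN, h⟩
    obtain rfl : N = n := by omega
    exact h
  · exact fun h => ⟨n, by omega, h⟩

lemma IsPCMAux.mem_border_iff {n : ℕ} (hX : IsPCMAux (n + 2) X) {h : α} :
    h ∈ border X ↔ h ∈ X ∧ ¬ IsSurfaceAux (n + 1) (thetaS X h) := by
  have := hX.1
  rw [border, Set.mem_ofPred_eq, isSurface_natCast_sub_one (n := n + 1)]
  push_cast
  omega

lemma IsPCMAux.not_isSurfaceAux {n : ℕ} (hX : IsPCMAux (n + 1) X) :
    ¬ IsSurfaceAux (n + 1) X := by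
  intro hS
  rcases n with _ | n
  · obtain ⟨x, rfl⟩ := hX
    exact Set.not_nontrivial_singleton hS.nontrivial
  · obtain ⟨h, hh⟩ := Set.nonempty_iff_ne_empty.2 hX.2.2.1
    rw [hX.mem_border_iff] at hh
    exact hh.2 (hS.thetaS hh.1)

/-- If a join is a PCM and its lower part is a surface, then its upper part is a nonempty PCM. -/
lemma IsPCMAux.of_join {N m : ℕ} (hAB : ∀ a ∈ A, ∀ b ∈ B, a < b)
    (h : IsPCMAux (N + 1) (A ∪ B)) (hA : IsSurfaceAux m A) :
    ∃ l, N = m + l ∧ IsPCMAux (l + 1) B := by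
  induction m generalizing N A with
  | zero =>
    obtain rfl : A = ∅ := hA
    exact ⟨N, by omega, by simpa using h⟩
  | succ m ih =>
    obtain ⟨x, hx⟩ := hA.nonempty
    rcases N with _ | N
    · obtain ⟨y, hy⟩ := h
      have := hA.nontrivial.mono Set.subset_union_left (t := A ∪ B)
      rw [hy] at this
      exact absurd this Set.not_nontrivial_singleton
    have hAB' : ∀ a ∈ thetaS A x, ∀ b ∈ B, a < b := fun a ha => hAB a (mem_thetaS.1 ha).1
    have hθ := h.2.2.2 x (Or.inl hx)
    rw [thetaS_join_left hAB hx] at hθ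
    by_cases hb : x ∈ border (A ∪ B)
    · obtain ⟨l, hl, hB⟩ := ih hAB' (hθ.1 hb) (hA.thetaS hx)
      exact ⟨l, by omega, hB⟩
    · obtain ⟨l, hl, hB⟩ := (hθ.2 hb).of_join hAB' (hA.thetaS hx)
      refine absurd ?_ h.not_isSurfaceAux
      have := hA.join hAB hB
      rwa [show m + 1 + l = N + 1 + 1 by omega] at this

end Join

section Simplices

variable {V : Type*} [DecidableEq V]

lemma isConnected_Ioo {s t : Finset V} (hc : s.card + 3 ≤ t.card) :
    IsConnected (Set.Ioo s t) := by
  have hlt : ∀ {x y : Finset V}, x ⊆ y → x.card < y.card → x < y := fun h hc =>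
    Finset.ssubset_iff_subset_ne.2 ⟨h, by rintro rfl; omega⟩
  have atom : ∀ x ∈ Set.Ioo s t, ∃ v ∈ t, v ∉ s ∧
      Relation.ReflTransGen (rel (Set.Ioo s t)) x (insert v s) ∧
      Relation.ReflTransGen (rel (Set.Ioo s t)) (insert v s) x := by
    rintro x ⟨hsx, hxt⟩
    obtain ⟨v, hvx, hvs⟩ := Finset.exists_of_ssubset hsx
    refine ⟨v, hxt.le hvx, hvs, ?_⟩
    have hle : insert v s ⊆ x := Finset.insert_subset hvx hsx.le
    rcases eq_or_ne (insert v s) x with he | hne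
    · rw [he]
      exact ⟨.refl, .refl⟩
    · have hr : rel (Set.Ioo s t) (insert v s) x :=
        rel.of_lt ⟨Finset.ssubset_insert hvs, (lt_of_le_of_ne hle hne).trans hxt⟩ ⟨hsx, hxt⟩
          (lt_of_le_of_ne hle hne)
      exact ⟨.single hr.symm, .single hr⟩
  intro x hx y hy
  have hst : s ⊆ t := (hx.1.trans hx.2).le
  obtain ⟨v, hvt, hvs, hxv, -⟩ := atom x hx
  obtain ⟨w, hwt, hws, -, hwy⟩ := atom y hy
  rcases eq_or_ne v w with rfl | hvw
  · exact hxv.trans hwy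
  have hv := Finset.card_insert_of_notMem hvs
  have hw := Finset.card_insert_of_notMem hws
  have hvw' : v ∉ insert w s := by simp [hvw, hvs]
  have hvwc := Finset.card_insert_of_notMem hvw'
  have hm : insert v (insert w s) ∈ Set.Ioo s t :=
    ⟨hlt (fun a ha => by simp [ha]) (by omega),
      hlt (Finset.insert_subset hvt (Finset.insert_subset hwt hst)) (by omega)⟩
  have hvm : rel (Set.Ioo s t) (insert v s) (insert v (insert w s)) :=
    rel.of_lt ⟨hlt (Finset.subset_insert _ _) (by omega),
      hlt (Finset.insert_subset hvt hst) (by omega)⟩ hm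
      (hlt (Finset.insert_subset_insert _ (Finset.subset_insert _ _)) (by omega))
  have hwm : rel (Set.Ioo s t) (insert w s) (insert v (insert w s)) :=
    rel.of_lt ⟨hlt (Finset.subset_insert _ _) (by omega),
      hlt (Finset.insert_subset hwt hst) (by omega)⟩ hm
      (hlt (Finset.subset_insert _ _) (by omega))
  exact hxv.trans (.head hvm (.head hwm.symm hwy))

/-- Open intervals of finite sets, in particular boundaries of simplices, are surfaces. -/
lemma isSurfaceAux_Ioo {k : ℕ} {s t : Finset V} (hst : s ⊆ t) (hc : t.card = s.card + k + 1) :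
    IsSurfaceAux k (Set.Ioo s t) := by
  induction k using Nat.strong_induction_on generalizing s t with
  | _ k ih =>
  rcases k with _ | _ | k
  · change _ = ∅
    ext x
    simp only [Set.mem_Ioo, Set.mem_empty_iff_false, iff_false]
    rintro ⟨h1, h2⟩
    have := Finset.card_lt_card h1
    have := Finset.card_lt_card h2
    omega
  · have hd : (t \ s).card = 2 := by rw [Finset.card_sdiff_of_subset hst]; omega
    obtain ⟨v, w, hvw, hd⟩ := Finset.card_eq_two.1 hd
    have hmem : ∀ a, a ∈ t ∧ a ∉ s ↔ a = v ∨ a = w := fun a => by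
      rw [← Finset.mem_sdiff, hd]; simp
    obtain ⟨hvt, hvs⟩ := (hmem v).2 (Or.inl rfl)
    obtain ⟨hwt, hws⟩ := (hmem w).2 (Or.inr rfl)
    have hv := Finset.card_insert_of_notMem hvs
    have hw := Finset.card_insert_of_notMem hws
    have hne : insert v s ≠ insert w s := fun he => by
      have : v ∈ insert w s := he ▸ Finset.mem_insert_self v s
      simp [hvw, hvs] at this
    refine ⟨insert v s, insert w s, hne, fun h => ?_, fun h => ?_, ?_⟩
    · have := Finset.card_lt_card h
      omega
    · have := Finset.card_lt_card h
      omega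
    ext x
    simp only [Set.mem_Ioo, Set.mem_insert_iff, Set.mem_singleton_iff]
    constructor
    · rintro ⟨h1, h2⟩
      have c1 := Finset.card_lt_card h1
      have c2 := Finset.card_lt_card h2
      obtain ⟨a, hax, has⟩ := Finset.exists_of_ssubset h1
      have hx : insert a s = x :=
        Finset.eq_of_subset_of_card_le (Finset.insert_subset hax h1.le)
          (by rw [Finset.card_insert_of_notMem has]; omega)
      rcases (hmem a).1 ⟨h2.le hax, has⟩ with rfl | rfl
      · exact Or.inl hx.symm
      · exact Or.inr hx.symm
    · have hlt : ∀ a ∈ t, a ∉ s → s < insert a s ∧ insert a s < t := fun a ha has =>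
        ⟨Finset.ssubset_insert has, Finset.ssubset_iff_subset_ne.2
          ⟨Finset.insert_subset ha hst, fun he => by
            have := Finset.card_insert_of_notMem has
            rw [he] at this
            omega⟩⟩
      rintro (rfl | rfl)
      · exact hlt v hvt hvs
      · exact hlt w hwt hws
  · have hlt : s ⊂ t := Finset.ssubset_iff_subset_ne.2 ⟨hst, by rintro rfl; omega⟩
    refine ⟨?_, isConnected_Ioo (by omega), ?_⟩
    · obtain ⟨v, hvt, hvs⟩ := Finset.exists_of_ssubset hlt
      refine ⟨insert v s, Finset.ssubset_insert hvs, Finset.ssubset_iff_subset_ne.2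
        ⟨Finset.insert_subset hvt hst, fun he => ?_⟩⟩
      have := Finset.card_insert_of_notMem hvs
      rw [he] at this
      omega
    · rintro x ⟨hsx, hxt⟩
      have c1 := Finset.card_lt_card hsx
      have c2 := Finset.card_lt_card hxt
      have hθ : thetaS (Set.Ioo s t) x = Set.Ioo s x ∪ Set.Ioo x t := by
        ext z
        simp only [mem_thetaS, Set.mem_Ioo, Set.mem_union]
        constructor
        · tauto
        · rintro (⟨h1, h2⟩ | ⟨h1, h2⟩)
          · exact ⟨⟨h1, h2.trans hxt⟩, Or.inl h2⟩
          · exact ⟨⟨hsx.trans h1, h2⟩, Or.inr h1⟩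
      rw [hθ]
      have := (ih (x.card - s.card - 1) (by omega) hsx.le (by omega)).join
        (fun a ha b hb => ha.2.trans hb.1)
        (ih (t.card - x.card - 1) (by omega) hxt.le (by omega))
      rwa [show x.card - s.card - 1 + (t.card - x.card - 1) = k + 1 by omega] at this

variable {X : Set (Finset V)} {h h' : Finset V}

lemma IsSimplicialComplex.thetaS_eq (hsc : IsSimplicialComplex X) (hh : h ∈ X) :
    thetaS X h = Set.Ioo ∅ h ∪ betaS X h := by
  ext z
  simp only [mem_thetaS, Set.mem_Ioo, Set.mem_union, betaS, Set.mem_ofPred_eq]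
  constructor
  · rintro ⟨hz, hlt | hlt⟩
    · exact Or.inl ⟨Finset.empty_ssubset.2 (hsc.2.1 z hz), hlt⟩
    · exact Or.inr ⟨hz, hlt⟩
  · rintro (⟨h0, hlt⟩ | ⟨hz, hlt⟩)
    · exact ⟨hsc.2.2.1 h hh z (Finset.empty_ssubset.1 h0) hlt.le, Or.inl hlt⟩
    · exact ⟨hz, Or.inr hlt⟩

lemma IsSimplicialComplex.thetaS_betaS_eq (hsc : IsSimplicialComplex X) (hh' : h' ∈ X)
    (hlt : h < h') : thetaS (betaS X h) h' = Set.Ioo h h' ∪ betaS X h' := by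
  ext z
  simp only [mem_thetaS, Set.mem_Ioo, Set.mem_union, betaS, Set.mem_ofPred_eq]
  constructor
  · tauto
  · rintro (⟨h0, hz⟩ | ⟨hz, hz'⟩)
    · exact ⟨⟨hsc.2.2.1 h' hh' z (Finset.card_pos.1 (by
        have := Finset.card_lt_card h0; omega)) hz.le, h0⟩, Or.inl hz⟩
    · exact ⟨⟨hz, hlt.trans hz'⟩, Or.inr hz'⟩

/-- The neighborhood of a simplex is a surface iff the set of simplices above it is one. -/
lemma IsSimplicialComplex.isSurfaceAux_thetaS_iff (hsc : IsSimplicialComplex X) (hh : h ∈ X)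
    {n : ℕ} : IsSurfaceAux n (thetaS X h) ↔
      ∃ l, n + 1 = h.card + l ∧ IsSurfaceAux l (betaS X h) := by
  have hpos := Finset.card_pos.2 (hsc.2.1 h hh)
  have hα : IsSurfaceAux (h.card - 1) (Set.Ioo ∅ h) :=
    isSurfaceAux_Ioo (Finset.empty_subset h) (by simp; omega)
  rw [hsc.thetaS_eq hh]
  constructor
  · intro hθ
    obtain ⟨l, hl, hβ⟩ := hθ.of_join Ioo_lt_betaS hα
    exact ⟨l, by omega, hβ⟩
  · rintro ⟨l, hl, hβ⟩
    have := hα.join Ioo_lt_betaS hβ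
    rwa [show h.card - 1 + l = n by omega] at this

/-- The border of a simplicial PCM is closed under taking faces. -/
lemma IsSimplicialComplex.mem_border_of_subset (hsc : IsSimplicialComplex X) {n : ℕ}
    (hX : IsPCMAux (n + 2) X) (hh : h ∈ X) (hh' : h' ∈ border X) (hle : h ⊆ h') :
    h ∈ border X := by
  rcases eq_or_ne h h' with rfl | hne
  · exact hh'
  have hlt : h < h' := lt_of_le_of_ne hle hne
  have hc := Finset.card_lt_card hlt
  rw [hX.mem_border_iff] at hh' ⊢
  refine ⟨hh, fun hS => hh'.2 ?_⟩
  rw [hsc.isSurfaceAux_thetaS_iff hh] at hS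
  rw [hsc.isSurfaceAux_thetaS_iff hh'.1]
  obtain ⟨l, hl, hS⟩ := hS
  have hmem : h' ∈ betaS X h := ⟨hh'.1, hlt⟩
  rcases l with _ | l
  · have h0 : betaS X h = ∅ := hS
    rw [h0] at hmem
    exact hmem.elim
  have hθ := hS.thetaS hmem
  rw [hsc.thetaS_betaS_eq hh'.1 hlt] at hθ
  obtain ⟨l', hl', hβ⟩ := hθ.of_join Ioo_lt_betaS
    (isSurfaceAux_Ioo (k := h'.card - h.card - 1) hle (by omega))
  exact ⟨l', by omega, hβ⟩

/-- A simplex over which the simplices of a complex form a PCM of dimension `l` is a face of a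
simplex with `l` more vertices over which they form a singleton. -/
lemma IsSimplicialComplex.exists_superset_isPCMAux_one (hsc : IsSimplicialComplex X) {l : ℕ}
    (hh : h ∈ X) (hβ : IsPCMAux (l + 1) (betaS X h)) :
    ∃ h' ∈ X, h ⊆ h' ∧ h'.card = h.card + l ∧ IsPCMAux 1 (betaS X h') := by
  induction l using Nat.strong_induction_on generalizing h with
  | _ l ih =>
  rcases l with _ | l
  · exact ⟨h, hh, subset_rfl, rfl, hβ⟩
  obtain ⟨g, hg⟩ := Set.nonempty_iff_ne_empty.2 hβ.2.2.1
  have hgβ : g ∈ X ∧ h < g := hg.1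
  have hc := Finset.card_lt_card hgβ.2
  have hθ := (hβ.2.2.2 g hg.1).1 hg
  rw [hsc.thetaS_betaS_eq hgβ.1 hgβ.2] at hθ
  obtain ⟨l', hl', hβ'⟩ := hθ.of_join Ioo_lt_betaS
    (isSurfaceAux_Ioo (k := g.card - h.card - 1) hgβ.2.le (by omega))
  obtain ⟨h', hh', hgh', hcard, hP⟩ := ih l' (by omega) hgβ.1 hβ'
  exact ⟨h', hh', hgβ.2.le.trans hgh', by omega, hP⟩

/-- Every border simplex of a simplicial PCM is a face of a border simplex of codimension one. -/
lemma IsSimplicialComplex.exists_border_superset (hsc : IsSimplicialComplex X) {n : ℕ}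
    (hX : IsPCMAux (n + 2) X) (hh : h ∈ border X) :
    ∃ h' ∈ border X, h'.card = n + 1 ∧ h ⊆ h' := by
  have hpos := Finset.card_pos.2 (hsc.2.1 h hh.1)
  have hθ := (hX.2.2.2 h hh.1).1 hh
  rw [hsc.thetaS_eq hh.1] at hθ
  obtain ⟨l, hl, hβ⟩ := hθ.of_join Ioo_lt_betaS
    (isSurfaceAux_Ioo (k := h.card - 1) (Finset.empty_subset h) (by simp; omega))
  obtain ⟨h', hh', hle, hcard, hP⟩ := hsc.exists_superset_isPCMAux_one hh.1 hβ
  refine ⟨h', hX.mem_border_iff.2 ⟨hh', fun hS => ?_⟩, by omega, hle⟩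
  obtain ⟨l', hl', hS⟩ := (hsc.isSurfaceAux_thetaS_iff hh').1 hS
  obtain rfl : l' = 1 := by omega
  exact hP.not_isSurfaceAux hS

end Simplices

/-- If `X` is at the same time a simplicial complex of rank `n ≥ 0` and an
`n`-PCM, then `ΔX` equals the downward closure of its `(n-1)`-dimensional simplices. -/
theorem statement_13 {V : Type*} [DecidableEq V] (X : Set (Finset V)) (n : ℤ) (hn : 0 ≤ n)
    (hsc : IsSimplicialComplex X) (hrk : rankSet X = n) (hpcm : IsPCM n X) :
    border X = {h | h ∈ X ∧ ∃ h' ∈ border X, dim h' = n - 1 ∧ h ⊆ h'} := by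
  obtain ⟨N, hN, hX⟩ := hpcm
  rcases N with _ | _ | N
  · omega
  · have hempty : border X = ∅ := by
      obtain ⟨x, rfl⟩ := hX
      refine Set.eq_empty_of_forall_notMem fun h hh => hh.2 ?_
      rw [isSurface_natCast_sub_one (n := 0) (by rw [hrk]; omega)]
      refine Set.eq_empty_of_forall_notMem fun z hz => ?_
      rw [mem_thetaS, hz.1, hh.1] at hz
      simp at hz
    simp [hempty]
  · ext h
    constructor
    · intro hh
      obtain ⟨h', hh', hcard, hle⟩ := hsc.exists_border_superset hX hh
      exact ⟨hh.1, h', hh', by rw [dim]; omega, hle⟩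
    · rintro ⟨hh, h', hh', -, hle⟩
      exact hsc.mem_border_of_subset hX hh hh' hle

end PCMPaper
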